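/- arXiv:2502.19709 — 6 statements merged into one kernel-verified Lean document; each statement's English description precedes it below -/
import Mathlib

section
/- Let A be a vector space over a field K of characteristic 0 equipped with an antisymmetric bilinear bracket [·,·] : A × A → A. Then the Malcev identity J(x,y,[x,z]) = [J(x,y,z),x] for all x,y,z ∈ A, where J(x,y,z) = [[x,y],z] + [[z,x],y] + [[y,z],x], holds if and only if Sagle's identity [[x,z],[y,t]] = [[[x,y],z],t] + [[[y,z],t],x] + [[[z,t],x],y] + [[[t,x],y],z] holds for all x,y,z,t ∈ A. -/
open scoped TensorProduct

namespace MPA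

variable (K : Type*) [Field K] [CharZero K]

section Basic
variable {A B V : Type*}
variable [AddCommGroup A] [Module K A] [AddCommGroup B] [Module K B]
variable [AddCommGroup V] [Module K V]

/-- A two-argument map is bilinear. -/
def IsBilin (m : A → A → B) : Prop :=
  (∀ x : A, IsLinearMap K (m x)) ∧ (∀ y : A, IsLinearMap K fun x => m x y)

/-- Bundle a bilinear two-argument map. -/
def mkBilin (m : A → A → B) (h : IsBilin K m) : A →ₗ[K] A →ₗ[K] B :=
  LinearMap.mk₂ K m (fun x y z => (h.2 z).map_add x y) (fun c x y => (h.2 y).map_smul c x)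
    (fun x y z => (h.1 x).map_add y z) (fun c x y => (h.1 x).map_smul c y)

/-- Bundle the left multiplications of a bilinear map as endomorphisms. -/
def mkEnd (m : A → A → A) (h : IsBilin K m) : A → Module.End K A :=
  fun x => IsLinearMap.mk' (m x) (h.1 x)

/-- The Jacobian `J(x,y,z) = [[x,y],z] + [[z,x],y] + [[y,z],x]`. -/
def Jacobian (br : A → A → A) (x y z : A) : A :=
  br (br x y) z + br (br z x) y + br (br y z) x

/-- Antisymmetry. -/
def IsSkew (br : A → A → A) : Prop := ∀ x y, br x y = - br y x

/-- Sagle's identity. -/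
def SagleIdentity (br : A → A → A) : Prop :=
  ∀ x y z t, br (br x z) (br y t) =
    br (br (br x y) z) t + br (br (br y z) t) x + br (br (br z t) x) y + br (br (br t x) y) z

/-- A Malcev algebra structure: an antisymmetric bilinear bracket satisfying Sagle's identity. -/
def IsMalcev (br : A → A → A) : Prop :=
  IsBilin K br ∧ IsSkew br ∧ SagleIdentity br

/-- A commutative associative algebra structure given by a bilinear product. -/
def IsCommAssoc (m : A → A → A) : Prop :=
  IsBilin K m ∧ (∀ x y, m x y = m y x) ∧ ∀ x y z, m (m x y) z = m x (m y z)

/-- A Malcev-Poisson algebra: a Malcev bracket and a commutative associative product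
satisfying the Leibniz rule. -/
def IsMalcevPoisson (br m : A → A → A) : Prop :=
  IsMalcev K br ∧ IsCommAssoc K m ∧
    ∀ x y z, br x (m y z) = m (br x y) z + m y (br x z)

/-- The defining identity of a representation of a Malcev algebra. -/
def IsMalcevRepMap (br : A → A → A) (ρ : A → Module.End K V) : Prop :=
  ∀ x y z, ρ (br (br x y) z) =
    ρ z * ρ y * ρ x - ρ y * ρ x * ρ z + ρ x * ρ (br y z) + ρ (br x z) * ρ y

/-- A representation of a Malcev algebra. -/
def IsMalcevRep (br : A → A → A) (ρ : A → Module.End K V) : Prop :=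
  IsLinearMap K ρ ∧ IsMalcevRepMap K br ρ

/-- A representation of a (commutative) associative algebra. -/
def IsAssocRep (m : A → A → A) (μ : A → Module.End K V) : Prop :=
  IsLinearMap K μ ∧ ∀ x y, μ (m x y) = μ x * μ y

/-- A representation of a Malcev-Poisson algebra. -/
def IsMPRep (br m : A → A → A) (ρ μ : A → Module.End K V) : Prop :=
  IsMalcevRep K br ρ ∧ IsAssocRep K m μ ∧
  (∀ x y, ρ (m x y) = μ y * ρ x + μ x * ρ y) ∧
  (∀ x y, μ (br x y) = ρ x * μ y - μ y * ρ x)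

/-- An `A`-module Malcev algebra. -/
def IsModuleMalcevAlg (br : A → A → A) (brV : V → V → V) (ρ : A → Module.End K V) : Prop :=
  IsMalcev K brV ∧ IsMalcevRep K br ρ ∧
  (∀ x y a b, ρ (br x y) (brV a b) =
      ρ x (brV (ρ y a) b) - brV (ρ y (ρ x a)) b - brV (ρ x (ρ y b)) a + ρ y (brV (ρ x b) a)) ∧
  (∀ x y a b, brV (ρ x a) (ρ y b) =
      brV (ρ (br x y) a) b - ρ x (brV (ρ y a) b) + ρ y (ρ x (brV a b)) + brV (ρ y (ρ x b)) a) ∧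
  (∀ x a b c, brV (ρ x a) (brV b c) =
      brV (brV (ρ x b) a) c - ρ x (brV (brV b a) c) - brV (ρ x (brV a c)) b - brV (brV (ρ x c) b) a)

/-- An `A`-module associative algebra. -/
def IsModuleAssocAlg (m : A → A → A) (mV : V → V → V) (μ : A → Module.End K V) : Prop :=
  IsCommAssoc K mV ∧ IsAssocRep K m μ ∧ ∀ x a b, μ x (mV a b) = mV (μ x a) b

/-- An `A`-module Malcev-Poisson algebra. -/
def IsModuleMP (br m : A → A → A) (brV mV : V → V → V) (ρ μ : A → Module.End K V) : Prop :=
  IsModuleMalcevAlg K br brV ρ ∧ IsModuleAssocAlg K m mV μ ∧ IsMPRep K br m ρ μ ∧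
  (∀ x a b, ρ x (mV a b) = mV (ρ x a) b + mV a (ρ x b)) ∧
  (∀ x a b, brV a (μ x b) = - mV (ρ x a) b + μ x (brV a b))

/-- The sub-adjacent bracket `{x,y} = x◇y − y◇x + [x,y]` of a post-Malcev algebra. -/
def pmBr (br dia : A → A → A) : A → A → A := fun x y => dia x y - dia y x + br x y

/-- The associated product `x∘y = x▷y + y▷x + x·y` of a commutative dendriform trialgebra. -/
def trialMul (mdot tri : A → A → A) : A → A → A := fun x y => tri x y + tri y x + mdot x y

/-- A post-Malcev algebra. -/
def IsPostMalcev (br dia : A → A → A) : Prop :=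
  IsMalcev K br ∧ IsBilin K dia ∧
  (∀ x y z t, dia (pmBr br dia x z) (br y t) =
      dia x (br (dia z y) t) - br (dia z (dia x y)) t - br (dia x (dia z t)) y
        + dia z (br (dia x t) y)) ∧
  (∀ x y z t, br (dia x z) (dia y t) =
      br (dia (pmBr br dia x y) z) t - dia x (br (dia y z) t) + dia y (dia x (br z t))
        + br (dia y (dia x t)) z) ∧
  (∀ x y z t, br (dia x z) (br y t) =
      br (br (dia x y) z) t - dia x (br (br y z) t) - br (dia x (br z t)) y
        - br (br (dia x t) y) z) ∧
  (∀ x y z t, dia (pmBr br dia y z) (dia x t) =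
      dia (pmBr br dia (pmBr br dia x y) z) t + dia y (dia (pmBr br dia x z) t)
        + dia x (dia y (dia z t)) - dia z (dia x (dia y t)))

/-- A commutative dendriform trialgebra. -/
def IsCommTridend (mdot tri : A → A → A) : Prop :=
  IsCommAssoc K mdot ∧ IsBilin K tri ∧
  (∀ x y z, tri (trialMul mdot tri x y) z = tri x (tri y z)) ∧
  (∀ x y z, mdot (tri x y) z = tri x (mdot y z))

/-- A post-Malcev-Poisson algebra. -/
def IsPostMP (br dia mdot tri : A → A → A) : Prop :=
  IsMalcevPoisson K br mdot ∧ IsPostMalcev K br dia ∧ IsCommTridend K mdot tri ∧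
  (∀ x y z, dia x (mdot y z) = mdot (dia x y) z + mdot y (dia x z)) ∧
  (∀ x y z, br x (tri z y) = tri z (br x y) - mdot y (dia z x)) ∧
  (∀ x y z, dia (trialMul mdot tri y z) x = tri z (dia y x) + tri y (dia z x)) ∧
  (∀ x y z, tri (pmBr br dia x z) y = dia x (tri z y) - tri z (dia x y))

/-- The dual representation `ρ*(x) = −ρ(x)*`. -/
def dualRepNeg (ρ : A → Module.End K V) : A → Module.End K (Module.Dual K V) :=
  fun x => -(ρ x).dualMap

/-- The dual map `x ↦ μ(x)*` (used for `−μ*`). -/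
def dualRepPos (μ : A → Module.End K V) : A → Module.End K (Module.Dual K V) :=
  fun x => (μ x).dualMap

end Basic

section Matched
variable {A1 A2 : Type*} [AddCommGroup A1] [Module K A1] [AddCommGroup A2] [Module K A2]

/-- Identities (M1), (M3), (M5) of a matched pair of Malcev algebras. -/
def MalcevCompatHalf (br1 : A1 → A1 → A1) (br2 : A2 → A2 → A2)
    (ρ1 : A1 → Module.End K A2) (ρ2 : A2 → Module.End K A1) : Prop :=
  (∀ (x1 y1 z1 : A1) (x2 : A2),
      br1 (br1 (ρ2 x2 x1) y1) z1 - br1 (ρ2 x2 (br1 y1 z1)) x1 - br1 (ρ2 (ρ1 x1 x2) y1) z1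
      - br1 (br1 (ρ2 x2 z1) x1) y1 + ρ2 (ρ1 y1 (ρ1 x1 x2)) z1 + br1 (br1 x1 z1) (ρ2 x2 y1)
      - ρ2 x2 (br1 (br1 x1 y1) z1) + ρ2 (ρ1 y1 x2) (br1 x1 z1) + br1 (ρ2 (ρ1 z1 x2) x1) y1
      + ρ2 (ρ1 (br1 y1 z1) x2) x1 - ρ2 (ρ1 x1 (ρ1 z1 x2)) y1 = 0) ∧
  (∀ (x1 y1 : A1) (x2 y2 : A2),
      ρ2 (ρ1 x1 (br2 x2 y2)) y1 - ρ2 (ρ1 x1 x2) (ρ2 y2 y1) + ρ2 x2 (br1 (ρ2 y2 x1) y1)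
      - br1 (ρ2 y2 (ρ2 x2 y1)) x1 - br1 (ρ2 (br2 x2 y2) x1) y1 + ρ2 (ρ1 y1 y2) (ρ2 x2 x1)
      - ρ2 (br2 (ρ1 y1 x2) y2) x1 - ρ2 y2 (ρ2 x2 (br1 x1 y1)) + br1 (ρ2 x2 x1) (ρ2 y2 y1)
      - ρ2 x2 (ρ2 (ρ1 x1 y2) y1) + ρ2 (ρ1 (ρ2 x2 y1) y2) x1 = 0) ∧
  (∀ (x1 y1 : A1) (x2 y2 : A2),
      ρ2 x2 (br1 (ρ2 y2 y1) x1) - ρ2 (br2 (ρ1 x1 y2) x2) y1 - br1 (ρ2 x2 (ρ2 y2 x1)) y1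
      + ρ2 y2 (br1 (ρ2 x2 x1) y1) - br1 (ρ2 y2 (ρ2 x2 y1)) x1 - ρ2 (br2 (ρ1 y1 x2) y2) x1
      - ρ2 y2 (ρ2 (ρ1 x1 x2) y1) - ρ2 x2 (ρ2 (ρ1 y1 y2) x1) + ρ2 (br2 x2 y2) (br1 x1 y1)
      + ρ2 (ρ1 (ρ2 x2 y1) y2) x1 + ρ2 (ρ1 (ρ2 y2 x1) x2) y1 = 0)

/-- A matched pair of Malcev algebras. -/
def IsMatchedPairMalcev (br1 : A1 → A1 → A1) (br2 : A2 → A2 → A2)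
    (ρ1 : A1 → Module.End K A2) (ρ2 : A2 → Module.End K A1) : Prop :=
  IsMalcev K br1 ∧ IsMalcev K br2 ∧ IsMalcevRep K br1 ρ1 ∧ IsMalcevRep K br2 ρ2 ∧
  MalcevCompatHalf K br1 br2 ρ1 ρ2 ∧ MalcevCompatHalf K br2 br1 ρ2 ρ1

/-- A matched pair of commutative associative algebras. -/
def IsMatchedPairComm (m1 : A1 → A1 → A1) (m2 : A2 → A2 → A2)
    (μ1 : A1 → Module.End K A2) (μ2 : A2 → Module.End K A1) : Prop :=
  IsCommAssoc K m1 ∧ IsCommAssoc K m2 ∧ IsAssocRep K m1 μ1 ∧ IsAssocRep K m2 μ2 ∧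
  (∀ (x1 : A1) (x2 y2 : A2), μ1 x1 (m2 x2 y2) = m2 (μ1 x1 x2) y2 + μ1 (μ2 x2 x1) y2) ∧
  (∀ (x2 : A2) (x1 y1 : A1), μ2 x2 (m1 x1 y1) = m1 (μ2 x2 x1) y1 + μ2 (μ1 x1 x2) y1)

/-- A matched pair of Malcev-Poisson algebras. -/
def IsMatchedPairMP (br1 m1 : A1 → A1 → A1) (br2 m2 : A2 → A2 → A2)
    (ρ1 μ1 : A1 → Module.End K A2) (ρ2 μ2 : A2 → Module.End K A1) : Prop :=
  IsMatchedPairMalcev K br1 br2 ρ1 ρ2 ∧ IsMatchedPairComm K m1 m2 μ1 μ2 ∧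
  IsMPRep K br1 m1 ρ1 μ1 ∧ IsMPRep K br2 m2 ρ2 μ2 ∧
  (∀ (x2 : A2) (x1 y1 : A1),
      ρ2 x2 (m1 x1 y1) =
        m1 (ρ2 x2 x1) y1 + m1 x1 (ρ2 x2 y1) - μ2 (ρ1 x1 x2) y1 - μ2 (ρ1 y1 x2) x1) ∧
  (∀ (x1 : A1) (x2 y2 : A2),
      ρ1 x1 (m2 x2 y2) =
        m2 (ρ1 x1 x2) y2 + m2 x2 (ρ1 x1 y2) - μ1 (ρ2 x2 x1) y2 - μ1 (ρ2 y2 x1) x2) ∧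
  (∀ (x1 y1 : A1) (x2 : A2),
      br1 x1 (μ2 x2 y1) - ρ2 (μ1 y1 x2) x1 =
        μ2 (ρ1 x1 x2) y1 - m1 (ρ2 x2 x1) y1 + μ2 x2 (br1 x1 y1)) ∧
  (∀ (x2 y2 : A2) (x1 : A1),
      br2 x2 (μ1 x1 y2) - ρ1 (μ2 y2 x1) x2 =
        μ1 (ρ2 x2 x1) y2 - m2 (ρ1 x1 x2) y2 + μ1 x1 (br2 x2 y2))

/-- The bracket on the direct sum of a (candidate) matched pair. -/
def prodBr (br1 : A1 → A1 → A1) (br2 : A2 → A2 → A2)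
    (ρ1 : A1 → Module.End K A2) (ρ2 : A2 → Module.End K A1) :
    A1 × A2 → A1 × A2 → A1 × A2 :=
  fun p q => (br1 p.1 q.1 + ρ2 p.2 q.1 - ρ2 q.2 p.1, br2 p.2 q.2 + ρ1 p.1 q.2 - ρ1 q.1 p.2)

/-- The product on the direct sum of a (candidate) matched pair. -/
def prodMul (m1 : A1 → A1 → A1) (m2 : A2 → A2 → A2)
    (μ1 : A1 → Module.End K A2) (μ2 : A2 → Module.End K A1) :
    A1 × A2 → A1 × A2 → A1 × A2 :=
  fun p q => (m1 p.1 q.1 + μ2 p.2 q.1 + μ2 q.2 p.1, m2 p.2 q.2 + μ1 p.1 q.2 + μ1 q.1 p.2)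

end Matched

section Tensor
variable {A : Type*} [AddCommGroup A] [Module K A]

/-- The binary operation on the dual space induced by a comultiplication:
`⟨x, op(ξ,η)⟩ = ⟨δ(x), ξ⊗η⟩`. -/
noncomputable def dualOp (δ : A →ₗ[K] A ⊗[K] A) :
    Module.Dual K A → Module.Dual K A → Module.Dual K A :=
  fun ξ η => TensorProduct.lift (ξ.smulRight η) ∘ₗ δ

/-- The cyclic permutation `σ(x⊗y⊗z⊗t) = y⊗z⊗t⊗x`. -/
noncomputable def cyc4 : (((A ⊗[K] A) ⊗[K] A) ⊗[K] A) →ₗ[K] (((A ⊗[K] A) ⊗[K] A) ⊗[K] A) :=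
  (TensorProduct.comm K A ((A ⊗[K] A) ⊗[K] A)).toLinearMap ∘ₗ
    (TensorProduct.assoc K A (A ⊗[K] A) A).toLinearMap ∘ₗ
      (TensorProduct.congr (TensorProduct.assoc K A A A) (LinearEquiv.refl K A)).toLinearMap

/-- A Malcev coalgebra. -/
noncomputable def IsMalcevCoalg (δ : A →ₗ[K] A ⊗[K] A) : Prop :=
  ((TensorProduct.comm K A A).toLinearMap ∘ₗ δ = -δ) ∧
  ((TensorProduct.assoc K (A ⊗[K] A) A A).symm.toLinearMap ∘ₗ TensorProduct.map δ δ ∘ₗ δ =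
    (LinearMap.id + cyc4 K + cyc4 K ∘ₗ cyc4 K + cyc4 K ∘ₗ cyc4 K ∘ₗ cyc4 K) ∘ₗ
      TensorProduct.map (TensorProduct.map δ LinearMap.id) LinearMap.id ∘ₗ
        TensorProduct.map δ LinearMap.id ∘ₗ δ)

/-- A cocommutative coassociative coalgebra. -/
def IsCoCommCoassoc (Δ : A →ₗ[K] A ⊗[K] A) : Prop :=
  ((TensorProduct.comm K A A).toLinearMap ∘ₗ Δ = Δ) ∧
  (TensorProduct.map LinearMap.id Δ ∘ₗ Δ =
    (TensorProduct.assoc K A A A).toLinearMap ∘ₗ TensorProduct.map Δ LinearMap.id ∘ₗ Δ)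

/-- A Malcev-Poisson coalgebra. -/
noncomputable def IsMPCoalg (Δ δ : A →ₗ[K] A ⊗[K] A) : Prop :=
  IsCoCommCoassoc K Δ ∧ IsMalcevCoalg K δ ∧
  TensorProduct.map LinearMap.id Δ ∘ₗ δ
    - (TensorProduct.assoc K A A A).toLinearMap ∘ₗ TensorProduct.map δ LinearMap.id ∘ₗ Δ
    - (TensorProduct.leftComm K A A A).toLinearMap ∘ₗ TensorProduct.map LinearMap.id δ ∘ₗ Δ = 0

/-- The bracket as a linear map on the tensor square. -/
noncomputable def brTensor (br : A → A → A) (h : IsBilin K br) : A ⊗[K] A →ₗ[K] A :=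
  TensorProduct.lift (mkBilin K br h)

/-- `(id⊗m⊗id)(id⊗τ⊗id) : (a⊗b)⊗(c⊗d) ↦ a⊗([c,b]⊗d)`. -/
noncomputable def mixA (br : A → A → A) (h : IsBilin K br) :
    (A ⊗[K] A) ⊗[K] (A ⊗[K] A) →ₗ[K] A ⊗[K] (A ⊗[K] A) :=
  TensorProduct.map LinearMap.id (TensorProduct.map (brTensor K br h) LinearMap.id) ∘ₗ
    TensorProduct.map LinearMap.id (TensorProduct.assoc K A A A).symm.toLinearMap ∘ₗ
      TensorProduct.map LinearMap.id (TensorProduct.leftComm K A A A).toLinearMap ∘ₗ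
        (TensorProduct.assoc K A A (A ⊗[K] A)).toLinearMap

/-- `(id⊗id⊗m)(id⊗τ⊗id) : (a⊗b)⊗(c⊗d) ↦ a⊗(c⊗[b,d])`. -/
noncomputable def mixB (br : A → A → A) (h : IsBilin K br) :
    (A ⊗[K] A) ⊗[K] (A ⊗[K] A) →ₗ[K] A ⊗[K] (A ⊗[K] A) :=
  TensorProduct.map LinearMap.id (TensorProduct.map LinearMap.id (brTensor K br h)) ∘ₗ
    TensorProduct.map LinearMap.id (TensorProduct.leftComm K A A A).toLinearMap ∘ₗ
      (TensorProduct.assoc K A A (A ⊗[K] A)).toLinearMap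

/-- Compatibility condition (B1) of a Malcev bialgebra. -/
def MalcevBialgB1 (br : A → A → A) (h : IsBilin K br) (δ : A →ₗ[K] A ⊗[K] A) : Prop :=
  ∀ x y z : A,
    δ (br (br x y) z)
      + TensorProduct.map LinearMap.id (mkEnd K br h x) (δ (br y z))
      + TensorProduct.map (mkEnd K br h y) LinearMap.id (δ (br x z))
    = TensorProduct.map (mkEnd K br h (br z y)) LinearMap.id (δ x)
      + TensorProduct.map (mkEnd K br h z) (mkEnd K br h y) (δ x)
      + TensorProduct.map LinearMap.id (mkEnd K br h z ∘ₗ mkEnd K br h y) (δ x)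
      - TensorProduct.map (mkEnd K br h z ∘ₗ mkEnd K br h x) LinearMap.id (δ y)
      - TensorProduct.map (mkEnd K br h x) (mkEnd K br h z) (δ y)
      + TensorProduct.map LinearMap.id (mkEnd K br h (br x z)) (δ y)
      + TensorProduct.map (mkEnd K br h x ∘ₗ mkEnd K br h y) LinearMap.id (δ z)
      - TensorProduct.map LinearMap.id (mkEnd K br h y ∘ₗ mkEnd K br h x) (δ z)

/-- Compatibility condition (B2) of a Malcev bialgebra. -/
noncomputable def MalcevBialgB2 (br : A → A → A) (h : IsBilin K br) (δ : A →ₗ[K] A ⊗[K] A) :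
    Prop :=
  ∀ x y : A,
    TensorProduct.map LinearMap.id δ (δ (br x y))
    = TensorProduct.map LinearMap.id (TensorProduct.map LinearMap.id (mkEnd K br h x))
        (TensorProduct.map LinearMap.id δ (δ y))
      + (TensorProduct.assoc K A A A).toLinearMap
          (TensorProduct.map δ LinearMap.id (TensorProduct.map (mkEnd K br h x) LinearMap.id (δ y)))
      + mixA K br h (δ y ⊗ₜ[K] δ x)
      - TensorProduct.map (mkEnd K br h y) LinearMap.id
          ((TensorProduct.assoc K A A A).toLinearMap (TensorProduct.map δ LinearMap.id (δ x)))
      - TensorProduct.map LinearMap.id (TensorProduct.map LinearMap.id (mkEnd K br h y))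
          ((TensorProduct.assoc K A A A).toLinearMap (TensorProduct.map δ LinearMap.id (δ x)))
      + mixB K br h (δ x ⊗ₜ[K] δ y)
      - TensorProduct.map LinearMap.id (TensorProduct.comm K A A).toLinearMap
          (TensorProduct.map LinearMap.id (TensorProduct.map LinearMap.id (mkEnd K br h x))
            ((TensorProduct.assoc K A A A).toLinearMap (TensorProduct.map δ LinearMap.id (δ y))))
      + TensorProduct.map LinearMap.id (TensorProduct.comm K A A).toLinearMap
          ((TensorProduct.assoc K A A A).toLinearMap
            (TensorProduct.map δ LinearMap.id (TensorProduct.map (mkEnd K br h y) LinearMap.id (δ x))))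
      - TensorProduct.map LinearMap.id (TensorProduct.map (mkEnd K br h y) LinearMap.id)
          (TensorProduct.map LinearMap.id δ (δ x))
      + TensorProduct.map LinearMap.id (TensorProduct.comm K A A).toLinearMap
          (TensorProduct.map (mkEnd K br h x) LinearMap.id
            ((TensorProduct.assoc K A A A).toLinearMap (TensorProduct.map δ LinearMap.id (δ y))))

end Tensor

section Coadj
variable {A : Type*} [AddCommGroup A] [Module K A] [Module.IsReflexive K A]

/-- The coadjoint-type action of a bracket on the dual space, transported back to `A`
through the canonical isomorphism `A ≃ A**`:
`⟨coadjDouble(ξ)x, η⟩ = −⟨x, [ξ,η]*⟩`. -/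
noncomputable def coadjDouble (brS : Module.Dual K A → Module.Dual K A → Module.Dual K A)
    (h : IsBilin K brS) : Module.Dual K A → Module.End K A :=
  fun ξ => -((Module.evalEquiv K A).symm.toLinearMap ∘ₗ
      (IsLinearMap.mk' (brS ξ) (h.1 ξ)).dualMap ∘ₗ (Module.evalEquiv K A).toLinearMap)

/-- `⟨comulDouble(ξ)x, η⟩ = ⟨x, ξ∘η⟩` : the action `−L*` of the dual product, transported
back to `A` through `A ≃ A**`. -/
noncomputable def comulDouble (mS : Module.Dual K A → Module.Dual K A → Module.Dual K A)
    (h : IsBilin K mS) : Module.Dual K A → Module.End K A :=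
  fun ξ => (Module.evalEquiv K A).symm.toLinearMap ∘ₗ
      (IsLinearMap.mk' (mS ξ) (h.1 ξ)).dualMap ∘ₗ (Module.evalEquiv K A).toLinearMap

end Coadj

section Bilin
variable {𝕜 : Type*} [Field 𝕜] {A B : Type*} [AddCommGroup A] [Module 𝕜 A]
  [AddCommGroup B] [Module 𝕜 B] {m : A → A → B} {br : A → A → A}

theorem IsBilin.add_left (h : IsBilin 𝕜 m) (x y z : A) : m (x + y) z = m x z + m y z :=
  (h.2 z).map_add x y

theorem IsBilin.add_right (h : IsBilin 𝕜 m) (x y z : A) : m x (y + z) = m x y + m x z :=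
  (h.1 x).map_add y z

theorem IsBilin.neg_left (h : IsBilin 𝕜 m) (x y : A) : m (-x) y = -m x y :=
  (h.2 y).map_neg x

theorem IsBilin.neg_right (h : IsBilin 𝕜 m) (x y : A) : m x (-y) = -m x y :=
  (h.1 x).map_neg y

theorem IsBilin.zero_left (h : IsBilin 𝕜 m) (y : A) : m 0 y = 0 :=
  (h.2 y).map_zero

/-- The polarization in `x` of the Malcev identity `J(x,y,[x,z]) = [J(x,y,z),x]`. -/
theorem Jacobian.malcev_polarized (hbil : IsBilin 𝕜 br)
    (h : ∀ x y z : A, Jacobian br x y (br x z) = br (Jacobian br x y z) x) (x w y z : A) :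
    Jacobian br x y (br w z) + Jacobian br w y (br x z) =
      br (Jacobian br x y z) w + br (Jacobian br w y z) x := by
  have hxw := h (x + w) y z
  have hx := h x y z
  have hw := h w y z
  simp only [Jacobian, hbil.add_left, hbil.add_right] at hxw hx hw ⊢
  linear_combination (norm := module) hxw - hx - hw

end Bilin

section Sagle
variable {K} {A : Type*} [AddCommGroup A] [Module K A] {br : A → A → A}

/-- The Malcev identity implies Sagle's identity. -/
theorem SagleIdentity.of_malcev (hbil : IsBilin K br) (hskew : IsSkew br)
    (h : ∀ x y z : A, Jacobian br x y (br x z) = br (Jacobian br x y z) x) :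
    SagleIdentity br := by
  intro x y z t
  have h₁ := Jacobian.malcev_polarized hbil h x y z t
  have h₂ := Jacobian.malcev_polarized hbil h x z t y
  have h₃ := Jacobian.malcev_polarized hbil h t x y z
  simp only [Jacobian, hbil.add_left, hskew y x, hskew z x, hskew t x, hskew z y, hskew t y,
    hskew t z, hskew y (br _ _), hskew z (br _ _), hskew t (br _ _),
    hskew (br z t) (br x y), hskew (br y t) (br x z), hskew (br y z) (br x t),
    hbil.neg_left, hbil.neg_right] at h₁ h₂ h₃ ⊢
  linear_combination (norm := module) (1 / 2 : K) • h₁ - (1 / 2 : K) • h₂ + (1 / 2 : K) • h₃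

/-- Sagle's identity implies the Malcev identity. -/
theorem SagleIdentity.malcev (hbil : IsBilin K br) (hskew : IsSkew br)
    (h : SagleIdentity br) (x y z : A) :
    Jacobian br x y (br x z) = br (Jacobian br x y z) x := by
  have hz := h z x x y
  have hself : br x x = 0 := by
    linear_combination (norm := module) (1 / 2 : K) • hskew x x
  simp only [Jacobian, hbil.add_left, hself, hskew z x, hskew y (br _ _),
    hskew (br x z) (br x y), hbil.neg_left, hbil.zero_left] at hz ⊢
  linear_combination (norm := module) hz

end Sagle

/-- For an antisymmetric bilinear bracket, the Malcev identity
`J(x,y,[x,z]) = [J(x,y,z),x]` is equivalent to Sagle's identity. -/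
theorem malcev_identity_iff_sagle
    {A : Type*} [AddCommGroup A] [Module K A]
    (br : A → A → A) (hbil : IsBilin K br) (hskew : IsSkew br) :
    (∀ x y z : A, Jacobian br x y (br x z) = br (Jacobian br x y z) x) ↔
      SagleIdentity br := by
  exact ⟨SagleIdentity.of_malcev hbil hskew, fun h => h.malcev hbil hskew⟩

end MPA
end

section
/- Let (A,*) be an alternative algebra over a field K of characteristic 0, i.e. a vector space with a bilinear product * whose associator as(x,y,z) = (x*y)*z − x*(y*z) satisfies as(x,x,y) = 0 and as(x,y,y) = 0 for all x,y ∈ A. Then A with the commutator bracket [x,y] = x*y − y*x is a Malcev algebra: the bracket is antisymmetric and satisfies Sagle's identity [[x,z],[y,t]] = [[[x,y],z],t] + [[[y,z],t],x] + [[[z,t],x],y] + [[[t,x],y],z] for all x,y,z,t ∈ A. -/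
open scoped TensorProduct

namespace MPA

variable (K : Type*) [Field K] [CharZero K]

section Alternative
variable {R : Type*} [NonUnitalNonAssocRing R]

theorem associator_swap_left (hl : ∀ x y : R, associator x x y = 0) (x y z : R) :
    associator y x z = -associator x y z := by
  have h := hl (x + y) z
  have hx := hl x z
  have hy := hl y z
  simp only [associator_apply, add_mul, mul_add] at h hx hy ⊢
  linear_combination (norm := abel) h - hx - hy

theorem associator_swap_right (hr : ∀ x y : R, associator x y y = 0) (x y z : R) :
    associator x z y = -associator x y z := by
  have h := hr x (y + z)
  have hy := hr x y
  have hz := hr x z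
  simp only [associator_apply, add_mul, mul_add] at h hy hz ⊢
  linear_combination (norm := abel) h - hy - hz

theorem associator_rotate (hl : ∀ x y : R, associator x x y = 0)
    (hr : ∀ x y : R, associator x y y = 0) (x y z : R) :
    associator y z x = associator x y z := by
  rw [associator_swap_right hr, associator_swap_left hl, neg_neg]

/-- Kleinfeld's function, measuring the failure of the associator to be a derivation in its
first argument. -/
def kleinfeld (w x y z : R) : R :=
  associator (w * x) y z - x * associator w y z - associator x y z * w

theorem kleinfeld_swap_right (hr : ∀ x y : R, associator x y y = 0) (w x y z : R) :
    kleinfeld w x z y = -kleinfeld w x y z := by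
  simp only [kleinfeld, associator_swap_right hr _ y z, mul_neg, neg_mul]
  abel

theorem kleinfeld_rotate (hl : ∀ x y : R, associator x x y = 0)
    (hr : ∀ x y : R, associator x y y = 0) (w x y z : R) :
    kleinfeld z w x y = -kleinfeld w x y z := by
  have cocycle (a b c d : R) : associator (a * b) c d - associator (b * c) d a
      + associator (c * d) a b = a * associator b c d + associator a b c * d := by
    rw [associator_rotate hl hr a (b * c) d, ← associator_rotate hl hr (c * d) a b]
    linear_combination (norm := abel) -associator_cocycle a b c d
  have h₁ := cocycle w x y z
  have h₂ := cocycle x y z w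
  rw [associator_rotate hl hr w y z] at h₂
  simp only [kleinfeld]
  rw [← associator_rotate hl hr z x y]
  linear_combination (norm := abel) h₁ + h₂

theorem kleinfeld_swap_middle (hl : ∀ x y : R, associator x x y = 0)
    (hr : ∀ x y : R, associator x y y = 0) (w x y z : R) :
    kleinfeld w y x z = -kleinfeld w x y z := by
  rw [← kleinfeld_rotate hl hr w x y z, ← neg_neg (kleinfeld w y x z),
    ← kleinfeld_rotate hl hr w y x z, kleinfeld_swap_right hr z w x y, neg_neg]

theorem kleinfeld_swap_left (hl : ∀ x y : R, associator x x y = 0)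
    (hr : ∀ x y : R, associator x y y = 0) (w x y z : R) :
    kleinfeld x w y z = -kleinfeld w x y z := by
  rw [← kleinfeld_rotate hl hr w x y z, ← neg_neg (kleinfeld x w y z),
    ← kleinfeld_rotate hl hr x w y z, kleinfeld_swap_middle hl hr z w x y, neg_neg]

theorem associator_commutator_left (hl : ∀ x y : R, associator x x y = 0)
    (hr : ∀ x y : R, associator x y y = 0) (w x y z : R) :
    associator ⁅w, x⁆ y z =
      2 • kleinfeld w x y z - ⁅associator w y z, x⁆ + ⁅associator x y z, w⁆ := by
  have h := kleinfeld_swap_left hl hr w x y z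
  simp only [kleinfeld, associator_apply, Ring.lie_def, sub_mul, mul_sub] at h ⊢
  linear_combination (norm := abel) -h

theorem jacobian_commutator (hl : ∀ x y : R, associator x x y = 0)
    (hr : ∀ x y : R, associator x y y = 0) (x y z : R) :
    Jacobian (fun a b : R => ⁅a, b⁆) x y z = 6 • associator x y z := by
  have h₁ := associator_swap_left hl x y z
  have h₂ := associator_swap_right hr x y z
  have h₃ := associator_swap_left hl x z y
  have h₄ := associator_swap_right hr y x z
  have h₅ := associator_swap_right hr z x y
  simp only [Jacobian, associator_apply, Ring.lie_def, sub_mul, mul_sub] at *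
  linear_combination (norm := abel) h₄ - 2 • h₁ - h₅ + 2 • h₃ - 3 • h₂

theorem two_nsmul_sagle_commutator (x y z t : R) :
    2 • (⁅⁅x, z⁆, ⁅y, t⁆⁆ - (⁅⁅⁅x, y⁆, z⁆, t⁆ + ⁅⁅⁅y, z⁆, t⁆, x⁆ + ⁅⁅⁅z, t⁆, x⁆, y⁆
      + ⁅⁅⁅t, x⁆, y⁆, z⁆)) =
    -(⁅Jacobian (fun a b : R => ⁅a, b⁆) x y z, t⁆ + ⁅Jacobian (fun a b : R => ⁅a, b⁆) y z t, x⁆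
      + ⁅Jacobian (fun a b : R => ⁅a, b⁆) z t x, y⁆ + ⁅Jacobian (fun a b : R => ⁅a, b⁆) t x y, z⁆
      + Jacobian (fun a b : R => ⁅a, b⁆) ⁅x, y⁆ z t + Jacobian (fun a b : R => ⁅a, b⁆) ⁅y, z⁆ t x
      + Jacobian (fun a b : R => ⁅a, b⁆) ⁅z, t⁆ x y + Jacobian (fun a b : R => ⁅a, b⁆) ⁅t, x⁆ y z
      + Jacobian (fun a b : R => ⁅a, b⁆) ⁅x, z⁆ y t
      + Jacobian (fun a b : R => ⁅a, b⁆) ⁅y, t⁆ z x) := by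
  simp only [Jacobian, Ring.lie_def, sub_mul, mul_sub, add_mul, mul_add]
  abel

theorem sagleIdentity_commutator [IsAddTorsionFree R] (hl : ∀ x y : R, associator x x y = 0)
    (hr : ∀ x y : R, associator x y y = 0) : SagleIdentity (fun x y : R => ⁅x, y⁆) := by
  intro x y z t
  have h := two_nsmul_sagle_commutator x y z t
  simp only [jacobian_commutator hl hr, associator_commutator_left hl hr] at h
  rw [kleinfeld_swap_middle hl hr y z t x, kleinfeld_swap_middle hl hr x y z t,
    kleinfeld_rotate hl hr z t x y, kleinfeld_rotate hl hr t x y z,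
    kleinfeld_rotate hl hr x y z t, ← associator_rotate hl hr x z t,
    ← associator_rotate hl hr y t x, ← associator_rotate hl hr z x y,
    ← associator_rotate hl hr t y z, associator_rotate hl hr t x y,
    associator_rotate hl hr x y z, associator_swap_left hl y z t,
    associator_swap_left hl z t x] at h
  rw [← sub_eq_zero, ← nsmul_eq_zero_iff_right two_ne_zero, h]
  simp only [Ring.lie_def, neg_mul, mul_neg, smul_mul_assoc, mul_smul_comm]
  abel

end Alternative

/-- An alternative algebra is Malcev-admissible: the commutator
bracket `[x,y] = x*y − y*x` is a Malcev algebra structure. -/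
theorem alternative_commutator_isMalcev
    {A : Type*} [AddCommGroup A] [Module K A]
    (mul : A → A → A) (hbil : IsBilin K mul)
    (halt₁ : ∀ x y : A, mul (mul x x) y - mul x (mul x y) = 0)
    (halt₂ : ∀ x y : A, mul (mul x y) y - mul x (mul y y) = 0) :
    IsMalcev K (fun x y => mul x y - mul y x) := by
  refine ⟨⟨fun x => ((hbil.1 x).mk' _ - (hbil.2 x).mk' _).isLinear,
    fun y => ((hbil.2 y).mk' _ - (hbil.1 y).mk' _).isLinear⟩,
    fun x y => (neg_sub _ _).symm, ?_⟩
  let _ : NonUnitalNonAssocRing A :=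
    { ‹AddCommGroup A› with
      mul := mul
      left_distrib := fun x y z => (hbil.1 x).map_add y z
      right_distrib := fun x y z => (hbil.2 z).map_add x y
      zero_mul := fun x => (hbil.2 x).map_zero
      mul_zero := fun x => (hbil.1 x).map_zero }
  have : IsAddTorsionFree A := .of_isTorsionFree K A
  exact sagleIdentity_commutator (R := A) halt₁ halt₂

end MPA
end

section
/- Let (A,[·,·]) be a Malcev algebra over a field K of characteristic 0 and (V,ρ) a representation of (A,[·,·]) with V finite-dimensional. Define ρ* : A → End(V*) by (ρ*(x)ξ)(v) = −ξ(ρ(x)v) for x ∈ A, ξ ∈ V*, v ∈ V. Then (V*, ρ*) is a representation of the Malcev algebra (A,[·,·]). -/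
open scoped TensorProduct

namespace MPA

variable (K : Type*) [Field K] [CharZero K]

/-- The dual `(V*, ρ*)`, with `(ρ*(x)ξ)(v) = −ξ(ρ(x)v)`, of a representation
of a Malcev algebra is again a representation. -/
theorem dual_isMalcevRep
    {A V : Type*} [AddCommGroup A] [Module K A] [AddCommGroup V] [Module K V]
    [FiniteDimensional K V]
    (br : A → A → A) (hbr : IsMalcev K br)
    (ρ : A → Module.End K V) (hρ : IsMalcevRep K br ρ) :
    IsMalcevRep K br (dualRepNeg K ρ) := by
  obtain ⟨hbilin, hskew, -⟩ := hbr
  obtain ⟨hlin, hrep⟩ := hρ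
  refine ⟨⟨fun x y => ?_, fun c x => ?_⟩, fun x y z => ?_⟩
  · ext ξ v
    simp [dualRepNeg, hlin.map_add, add_comm]
  · ext ξ v
    simp [dualRepNeg, hlin.map_smul]
  · -- The representation identity at `(y, x, z)` is, by antisymmetry, the transpose of the goal.
    have hswap : ρ (br (br y x) z) = -ρ (br (br x y) z) := by
      rw [hskew y x, (hbilin.2 z).map_neg, hlin.map_neg]
    ext ξ v
    have h := congrArg ξ (LinearMap.congr_fun (hswap.symm.trans (hrep y x z)) v)
    simp only [dualRepNeg, LinearMap.neg_apply, LinearMap.add_apply, LinearMap.sub_apply,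
      Module.End.mul_apply, LinearMap.dualMap_apply, map_neg, map_add, map_sub] at h ⊢
    linear_combination h

end MPA
end

section
/- Let (A,[·,·],∘) be a Malcev-Poisson algebra over a field K of characteristic 0 and (V,ρ,μ) a representation of it. Then the direct sum A ⊕ V is a Malcev-Poisson algebra with the operations [x1+v1, x2+v2] = [x1,x2] + ρ(x1)v2 − ρ(x2)v1 and (x1+v1)∘(x2+v2) = x1∘x2 + μ(x1)v2 + μ(x2)v1 for x1,x2 ∈ A, v1,v2 ∈ V. -/
open scoped TensorProduct

namespace MPA

variable (K : Type*) [Field K] [CharZero K]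

/-- The semi-direct product of a Malcev-Poisson algebra with one of its
representations is a Malcev-Poisson algebra. -/
theorem semidirect_isMalcevPoisson
    {A V : Type*} [AddCommGroup A] [Module K A] [AddCommGroup V] [Module K V]
    (br m : A → A → A) (h : IsMalcevPoisson K br m)
    (ρ μ : A → Module.End K V) (hrep : IsMPRep K br m ρ μ) :
    IsMalcevPoisson K
      (fun p q : A × V => (br p.1 q.1, ρ p.1 q.2 - ρ q.1 p.2))
      (fun p q : A × V => (m p.1 q.1, μ p.1 q.2 + μ q.1 p.2)) := by
  obtain ⟨⟨hbr, hskew, hsagle⟩, ⟨hm, hcomm, hassoc⟩, hleib⟩ := h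
  obtain ⟨⟨hρ, hρrep⟩, ⟨hμ, hμmul⟩, hρm, hμbr⟩ := hrep
  have hμcomm (x y : A) (v : V) : μ x (μ y v) = μ y (μ x v) := by
    rw [← Module.End.mul_apply, ← Module.End.mul_apply, ← hμmul, ← hμmul, hcomm]
  refine ⟨⟨⟨fun p => ⟨fun q r => ?_, fun c q => ?_⟩, fun q => ⟨fun p r => ?_, fun c p => ?_⟩⟩,
    fun p q => ?_, fun p q r s => ?_⟩,
    ⟨⟨fun p => ⟨fun q r => ?_, fun c q => ?_⟩, fun q => ⟨fun p r => ?_, fun c p => ?_⟩⟩,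
    fun p q => ?_, fun p q r => ?_⟩, fun p q r => ?_⟩
  · ext
    · exact (hbr.1 p.1).map_add q.1 r.1
    · simp [hρ.map_add]; abel
  · ext
    · exact (hbr.1 p.1).map_smul c q.1
    · simp [hρ.map_smul, smul_sub]
  · ext
    · exact (hbr.2 q.1).map_add p.1 r.1
    · simp [hρ.map_add]; abel
  · ext
    · exact (hbr.2 q.1).map_smul c p.1
    · simp [hρ.map_smul, smul_sub]
  · ext
    · exact hskew p.1 q.1
    · simp
  · ext
    · exact hsagle p.1 q.1 r.1 s.1
    · have key (x y z : A) (v : V) := LinearMap.congr_fun (hρrep x y z) v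
      simp only [LinearMap.add_apply, LinearMap.sub_apply, Module.End.mul_apply] at key
      simp only [Prod.snd_add, map_sub, key]
      rw [hskew q.1 s.1, hskew p.1 r.1, hρ.map_neg, hρ.map_neg]
      simp only [LinearMap.neg_apply]
      abel
  · ext
    · exact (hm.1 p.1).map_add q.1 r.1
    · simp [hμ.map_add]; abel
  · ext
    · exact (hm.1 p.1).map_smul c q.1
    · simp [hμ.map_smul]
  · ext
    · exact (hm.2 q.1).map_add p.1 r.1
    · simp [hμ.map_add]; abel
  · ext
    · exact (hm.2 q.1).map_smul c p.1
    · simp [hμ.map_smul]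
  · ext
    · exact hcomm p.1 q.1
    · exact add_comm _ _
  · ext
    · exact hassoc p.1 q.1 r.1
    · simp only [hμmul, Module.End.mul_apply, map_add]
      rw [hμcomm r.1 p.1, hμcomm r.1 q.1]
      abel
  · ext
    · exact hleib p.1 q.1 r.1
    · simp only [hρm, hμbr, Prod.snd_add, LinearMap.add_apply, LinearMap.sub_apply,
        Module.End.mul_apply, map_add, map_sub]
      abel

end MPA
end

section
/- Let (A,[·,·],∘) be a Malcev-Poisson algebra over a field K of characteristic 0 and (V,ρ,μ) a representation of it with V finite-dimensional. Define ρ* : A → End(V*) by (ρ*(x)ξ)(v) = −ξ(ρ(x)v) and −μ* : A → End(V*) by ((−μ*)(x)ξ)(v) = ξ(μ(x)v). Then (V*, ρ*, −μ*) is a representation of the Malcev-Poisson algebra (A,[·,·],∘). -/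
open scoped TensorProduct

namespace MPA

variable (K : Type*) [Field K] [CharZero K]

section DualRep
variable {F A V : Type*} [Field F] [AddCommGroup A] [Module F A] [AddCommGroup V] [Module F V]
variable {br m : A → A → A} {ρ μ : A → Module.End F V}

/-- In a Malcev representation, the defining identity also holds with all products reversed
and signs changed according to degree. -/
theorem IsMalcevRep.map_br_br_reverse (hbr : IsMalcev F br) (hρ : IsMalcevRep F br ρ)
    (x y z : A) :
    ρ (br (br x y) z) =
      ρ x * ρ y * ρ z - ρ z * ρ x * ρ y - ρ (br y z) * ρ x - ρ y * ρ (br x z) := by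
  rw [hbr.2.1 x y, (hbr.1.2 z).map_neg, hρ.1.map_neg, hρ.2]
  abel

/-- The compatibility of `ρ` with the commutative product, with the factors reversed. -/
theorem IsMPRep.map_mul_reverse (hbr : IsSkew br) (h : IsMPRep F br m ρ μ) (x y : A) :
    ρ (m x y) = ρ x * μ y + ρ y * μ x := by
  have hxy := h.2.2.2 x y
  rw [hbr x y, h.2.1.1.map_neg, h.2.2.2 y x] at hxy
  rw [h.2.2.1, ← sub_eq_zero, ← sub_eq_zero.mpr hxy]
  abel

theorem IsMalcevRep.dual (hbr : IsMalcev F br) (hρ : IsMalcevRep F br ρ) :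
    IsMalcevRep F br (dualRepNeg F ρ) := by
  refine ⟨⟨fun x y => ?_, fun c x => ?_⟩, fun x y z => ?_⟩
  · ext ξ v
    simp [dualRepNeg, hρ.1.map_add, add_comm]
  · ext ξ v
    simp [dualRepNeg, hρ.1.map_smul]
  · ext ξ v
    simp only [dualRepNeg, hρ.map_br_br_reverse hbr x y z, LinearMap.neg_apply,
      LinearMap.add_apply, LinearMap.sub_apply, Module.End.mul_apply, LinearMap.dualMap_apply,
      map_neg, map_sub]
    ring

theorem IsAssocRep.dual (hm : ∀ x y, m x y = m y x) (hμ : IsAssocRep F m μ) :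
    IsAssocRep F m (dualRepPos F μ) := by
  refine ⟨⟨fun x y => ?_, fun c x => ?_⟩, fun x y => ?_⟩
  · ext ξ v
    simp [dualRepPos, hμ.1.map_add]
  · ext ξ v
    simp [dualRepPos, hμ.1.map_smul]
  · ext ξ v
    simp [dualRepPos, hm x y, hμ.2]

end DualRep

/-- The dual `(V*, ρ*, −μ*)` of a representation `(V,ρ,μ)` of a
Malcev-Poisson algebra is again a representation. -/
theorem dual_isMPRep
    {A V : Type*} [AddCommGroup A] [Module K A] [AddCommGroup V] [Module K V]
    [FiniteDimensional K V]
    (br m : A → A → A) (h : IsMalcevPoisson K br m)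
    (ρ μ : A → Module.End K V) (hrep : IsMPRep K br m ρ μ) :
    IsMPRep K br m (dualRepNeg K ρ) (dualRepPos K μ) := by
  refine ⟨hrep.1.dual h.1, hrep.2.1.dual h.2.1.2.1, fun x y => ?_, fun x y => ?_⟩
  · ext ξ v
    simp [dualRepNeg, dualRepPos, hrep.map_mul_reverse h.1.2.1 x y, add_comm]
  · ext ξ v
    simp [dualRepNeg, dualRepPos, hrep.2.2.2 x y, sub_eq_add_neg, add_comm]

end MPA
end

section
/- Let (A1,[·,·]1) and (A2,[·,·]2) be Malcev algebras over a field K of characteristic 0 and ρ1 : A1 → End(A2), ρ2 : A2 → End(A1) linear maps. Define a bracket on A1 ⊕ A2 by [x1+x2, y1+y2] = [x1,y1]1 + ρ2(x2)y1 − ρ2(y2)x1 + [x2,y2]2 + ρ1(x1)y2 − ρ1(y1)x2. Then (A1 ⊕ A2, [·,·]) is a Malcev algebra if and only if (A1,A2,ρ1,ρ2) is a matched pair of Malcev algebras. -/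
open scoped TensorProduct

namespace MPA

variable (K : Type*) [Field K] [CharZero K]

section SagleDefect
variable {F : Type*} [Field F]

/-- The difference of the two sides of Sagle's identity. -/
def sagleDefect {A : Type*} [AddCommGroup A] (br : A → A → A) (x y z t : A) : A :=
  br (br x z) (br y t) - (br (br (br x y) z) t + br (br (br y z) t) x +
    br (br (br z t) x) y + br (br (br t x) y) z)

theorem sagleIdentity_iff_sagleDefect_eq_zero {A : Type*} [AddCommGroup A] (br : A → A → A) :
    SagleIdentity br ↔ ∀ x y z t, sagleDefect br x y z t = 0 := by
  simp only [SagleIdentity, sagleDefect, sub_eq_zero]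

variable (F) in
theorem exists_bilin_of_isBilin {A B : Type*} [AddCommGroup A] [Module F A]
    [AddCommGroup B] [Module F B] {m : A → A → B} (h : IsBilin F m) :
    ∃ b : A →ₗ[F] A →ₗ[F] B, m = fun x y => b x y :=
  ⟨mkBilin F m h, rfl⟩

theorem isBilin_bilin {A B : Type*} [AddCommGroup A] [Module F A]
    [AddCommGroup B] [Module F B] (b : A →ₗ[F] A →ₗ[F] B) : IsBilin F fun x y => b x y :=
  ⟨fun x => (b x).isLinear, fun y => (b.flip y).isLinear⟩

section Bilinear
variable {A : Type*} [AddCommGroup A] [Module F A] (b : A →ₗ[F] A →ₗ[F] A)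

theorem sagleDefect_rotate (h : IsSkew fun x y => b x y) (x y z t : A) :
    sagleDefect (fun x y => b x y) x y z t = sagleDefect (fun x y => b x y) y z t x := by
  have h₁ : b (b y t) (b z x) = b (b x z) (b y t) := by
    rw [show b z x = -b x z from h z x, map_neg]
    exact (h (b x z) (b y t)).symm
  simp only [sagleDefect, h₁]
  abel

theorem sagleDefect_add_left (x x' y z t : A) :
    sagleDefect (fun x y => b x y) (x + x') y z t =
      sagleDefect (fun x y => b x y) x y z t + sagleDefect (fun x y => b x y) x' y z t := by
  simp only [sagleDefect, map_add, LinearMap.add_apply]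
  abel

end Bilinear

variable {A1 A2 : Type*} [AddCommGroup A1] [Module F A1] [AddCommGroup A2] [Module F A2]

/-- The direct sum bracket as a bundled bilinear map. -/
def prodBilin (b1 : A1 →ₗ[F] A1 →ₗ[F] A1) (b2 : A2 →ₗ[F] A2 →ₗ[F] A2)
    (ρ1 : A1 →ₗ[F] Module.End F A2) (ρ2 : A2 →ₗ[F] Module.End F A1) :
    (A1 × A2) →ₗ[F] (A1 × A2) →ₗ[F] (A1 × A2) :=
  LinearMap.mk₂ F (prodBr F (fun x y => b1 x y) (fun x y => b2 x y) ρ1 ρ2)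
    (fun _ _ _ => by
      ext <;> simp only [prodBr, Prod.fst_add, Prod.snd_add, map_add, LinearMap.add_apply] <;> abel)
    (fun _ _ _ => by
      ext <;> simp only [prodBr, Prod.smul_fst, Prod.smul_snd, map_smul, LinearMap.smul_apply,
        smul_add, smul_sub])
    (fun _ _ _ => by
      ext <;> simp only [prodBr, Prod.fst_add, Prod.snd_add, map_add, LinearMap.add_apply] <;> abel)
    (fun _ _ _ => by
      ext <;> simp only [prodBr, Prod.smul_fst, Prod.smul_snd, map_smul, LinearMap.smul_apply,
        smul_add, smul_sub])

variable (b1 : A1 →ₗ[F] A1 →ₗ[F] A1) (b2 : A2 →ₗ[F] A2 →ₗ[F] A2)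
    (ρ1 : A1 →ₗ[F] Module.End F A2) (ρ2 : A2 →ₗ[F] Module.End F A1)

theorem prodBilin_apply (p q : A1 × A2) :
    prodBilin b1 b2 ρ1 ρ2 p q =
      (b1 p.1 q.1 + ρ2 p.2 q.1 - ρ2 q.2 p.1, b2 p.2 q.2 + ρ1 p.1 q.2 - ρ1 q.1 p.2) := rfl

theorem isSkew_prodBilin (h1 : IsSkew fun x y => b1 x y) (h2 : IsSkew fun x y => b2 x y) :
    IsSkew fun p q => prodBilin b1 b2 ρ1 ρ2 p q := by
  intro p q
  ext
  · simp only [prodBilin_apply, Prod.fst_neg, show b1 p.1 q.1 = -b1 q.1 p.1 from h1 _ _]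
    abel
  · simp only [prodBilin_apply, Prod.snd_neg, show b2 p.2 q.2 = -b2 q.2 p.2 from h2 _ _]
    abel

theorem fst_sagleDefect_inl_inl_inl_inl (x y z t : A1) :
    (sagleDefect (fun p q => prodBilin b1 b2 ρ1 ρ2 p q) (x, 0) (y, 0) (z, 0) (t, 0)).1 =
      sagleDefect (fun x y => b1 x y) x y z t := by
  simp [sagleDefect, prodBilin_apply]

theorem fst_sagleDefect_inr_inr_inr_inr (x y z t : A2) :
    (sagleDefect (fun p q => prodBilin b1 b2 ρ1 ρ2 p q) (0, x) (0, y) (0, z) (0, t)).1 = 0 := by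
  simp [sagleDefect, prodBilin_apply]

theorem fst_sagleDefect_inl_inl_inl_inr (x1 y1 z1 : A1) (x2 : A2) :
    (sagleDefect (fun p q => prodBilin b1 b2 ρ1 ρ2 p q) (x1, 0) (y1, 0) (z1, 0) (0, x2)).1 =
      -(b1 (b1 (ρ2 x2 x1) y1) z1 - b1 (ρ2 x2 (b1 y1 z1)) x1 - b1 (ρ2 (ρ1 x1 x2) y1) z1
      - b1 (b1 (ρ2 x2 z1) x1) y1 + ρ2 (ρ1 y1 (ρ1 x1 x2)) z1 + b1 (b1 x1 z1) (ρ2 x2 y1)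
      - ρ2 x2 (b1 (b1 x1 y1) z1) + ρ2 (ρ1 y1 x2) (b1 x1 z1) + b1 (ρ2 (ρ1 z1 x2) x1) y1
      + ρ2 (ρ1 (b1 y1 z1) x2) x1 - ρ2 (ρ1 x1 (ρ1 z1 x2)) y1) := by
  simp only [sagleDefect, prodBilin_apply, Prod.fst_sub, Prod.fst_add, map_zero,
    LinearMap.zero_apply, map_add, map_sub, map_neg, LinearMap.add_apply, LinearMap.sub_apply,
    LinearMap.neg_apply, add_zero, zero_add, sub_zero, zero_sub]
  abel

theorem fst_sagleDefect_inl_inl_inr_inr (x1 y1 : A1) (x2 y2 : A2) :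
    (sagleDefect (fun p q => prodBilin b1 b2 ρ1 ρ2 p q) (x1, 0) (y1, 0) (0, x2) (0, y2)).1 =
      ρ2 (ρ1 x1 (b2 x2 y2)) y1 - ρ2 (ρ1 x1 x2) (ρ2 y2 y1) + ρ2 x2 (b1 (ρ2 y2 x1) y1)
      - b1 (ρ2 y2 (ρ2 x2 y1)) x1 - b1 (ρ2 (b2 x2 y2) x1) y1 + ρ2 (ρ1 y1 y2) (ρ2 x2 x1)
      - ρ2 (b2 (ρ1 y1 x2) y2) x1 - ρ2 y2 (ρ2 x2 (b1 x1 y1)) + b1 (ρ2 x2 x1) (ρ2 y2 y1)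
      - ρ2 x2 (ρ2 (ρ1 x1 y2) y1) + ρ2 (ρ1 (ρ2 x2 y1) y2) x1 := by
  simp only [sagleDefect, prodBilin_apply, Prod.fst_sub, Prod.fst_add, map_zero,
    LinearMap.zero_apply, map_add, map_neg, LinearMap.add_apply,
    LinearMap.neg_apply, add_zero, zero_add, sub_zero, zero_sub]
  abel

theorem fst_sagleDefect_inl_inr_inl_inr (x1 y1 : A1) (x2 y2 : A2) :
    (sagleDefect (fun p q => prodBilin b1 b2 ρ1 ρ2 p q) (x1, 0) (0, x2) (y1, 0) (0, y2)).1 =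
      -(ρ2 x2 (b1 (ρ2 y2 y1) x1) - ρ2 (b2 (ρ1 x1 y2) x2) y1 - b1 (ρ2 x2 (ρ2 y2 x1)) y1
      + ρ2 y2 (b1 (ρ2 x2 x1) y1) - b1 (ρ2 y2 (ρ2 x2 y1)) x1 - ρ2 (b2 (ρ1 y1 x2) y2) x1
      - ρ2 y2 (ρ2 (ρ1 x1 x2) y1) - ρ2 x2 (ρ2 (ρ1 y1 y2) x1) + ρ2 (b2 x2 y2) (b1 x1 y1)
      + ρ2 (ρ1 (ρ2 x2 y1) y2) x1 + ρ2 (ρ1 (ρ2 y2 x1) x2) y1) := by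
  simp only [sagleDefect, prodBilin_apply, Prod.fst_sub, Prod.fst_add, map_zero,
    LinearMap.zero_apply, map_add, map_sub, map_neg, LinearMap.add_apply, LinearMap.sub_apply,
    LinearMap.neg_apply, add_zero, zero_add, sub_zero, zero_sub]
  abel

theorem fst_sagleDefect_inr_inr_inr_inl (x2 y2 z2 : A2) (x1 : A1) :
    (sagleDefect (fun p q => prodBilin b1 b2 ρ1 ρ2 p q) (0, x2) (0, y2) (0, z2) (x1, 0)).1 =
      (ρ2 z2 * ρ2 y2 * ρ2 x2 - ρ2 y2 * ρ2 x2 * ρ2 z2 + ρ2 x2 * ρ2 (b2 y2 z2)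
        + ρ2 (b2 x2 z2) * ρ2 y2) x1 - ρ2 (b2 (b2 x2 y2) z2) x1 := by
  simp only [sagleDefect, prodBilin_apply, Prod.fst_sub, Prod.fst_add, map_zero,
    LinearMap.zero_apply, map_add, map_sub, map_neg, LinearMap.add_apply, LinearMap.sub_apply,
    LinearMap.neg_apply, add_zero, zero_add, sub_zero, zero_sub, Module.End.mul_apply]
  abel

/-- The first component of the Sagle defect of the direct sum bracket
vanishes as soon as it vanishes on one homogeneous quadruple from each rotation class. -/
theorem fst_sagleDefect_prodBilin_eq_zero
    (h1 : IsSkew fun x y => b1 x y) (h2 : IsSkew fun x y => b2 x y)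
    (h₀ : ∀ x y z t, sagleDefect (fun x y => b1 x y) x y z t = 0)
    (h₁ : ∀ (x y z : A1) (t : A2),
      (sagleDefect (fun p q => prodBilin b1 b2 ρ1 ρ2 p q) (x, 0) (y, 0) (z, 0) (0, t)).1 = 0)
    (h₂ : ∀ (x y : A1) (z t : A2),
      (sagleDefect (fun p q => prodBilin b1 b2 ρ1 ρ2 p q) (x, 0) (y, 0) (0, z) (0, t)).1 = 0)
    (h₃ : ∀ (x y : A1) (z t : A2),
      (sagleDefect (fun p q => prodBilin b1 b2 ρ1 ρ2 p q) (x, 0) (0, z) (y, 0) (0, t)).1 = 0)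
    (h₄ : ∀ (x y z : A2) (t : A1),
      (sagleDefect (fun p q => prodBilin b1 b2 ρ1 ρ2 p q) (0, x) (0, y) (0, z) (t, 0)).1 = 0)
    (p q r s : A1 × A2) :
    (sagleDefect (fun p q => prodBilin b1 b2 ρ1 ρ2 p q) p q r s).1 = 0 := by
  have rot (p q r s : A1 × A2) :
      (sagleDefect (fun p q => prodBilin b1 b2 ρ1 ρ2 p q) p q r s).1 =
        (sagleDefect (fun p q => prodBilin b1 b2 ρ1 ρ2 p q) q r s p).1 :=
    congrArg Prod.fst (sagleDefect_rotate _ (isSkew_prodBilin b1 b2 ρ1 ρ2 h1 h2) p q r s)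
  have split (p q r s : A1 × A2)
      (hl : (sagleDefect (fun p q => prodBilin b1 b2 ρ1 ρ2 p q) (p.1, 0) q r s).1 = 0)
      (hr : (sagleDefect (fun p q => prodBilin b1 b2 ρ1 ρ2 p q) (0, p.2) q r s).1 = 0) :
      (sagleDefect (fun p q => prodBilin b1 b2 ρ1 ρ2 p q) p q r s).1 = 0 := by
    rw [← Prod.fst_add_snd p, sagleDefect_add_left, Prod.fst_add, hl, hr, add_zero]
  have h₅ (x y z t : A1) :
      (sagleDefect (fun p q => prodBilin b1 b2 ρ1 ρ2 p q) (x, 0) (y, 0) (z, 0) (t, 0)).1 = 0 := by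
    rw [fst_sagleDefect_inl_inl_inl_inl, h₀]
  have h₆ := fst_sagleDefect_inr_inr_inr_inr b1 b2 ρ1 ρ2
  apply split <;> rw [rot] <;> apply split <;> rw [rot] <;> apply split <;> rw [rot] <;>
    apply split <;>
    first
    | simp only [h₁, h₂, h₃, h₄, h₅, h₆]
    | (rw [rot]; simp only [h₁, h₂, h₃, h₄])
    | (rw [rot, rot]; simp only [h₁, h₂, h₄])
    | (rw [rot, rot, rot]; simp only [h₁, h₂, h₄])

theorem fst_sagleDefect_prodBilin_eq_zero_iff
    (h1 : IsSkew fun x y => b1 x y) (h2 : IsSkew fun x y => b2 x y)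
    (h₀ : SagleIdentity fun x y => b1 x y) :
    (∀ p q r s, (sagleDefect (fun p q => prodBilin b1 b2 ρ1 ρ2 p q) p q r s).1 = 0) ↔
      IsMalcevRepMap F (fun x y => b2 x y) ρ2 ∧
        MalcevCompatHalf F (fun x y => b1 x y) (fun x y => b2 x y) ρ1 ρ2 := by
  constructor
  · intro h
    refine ⟨fun x y z => LinearMap.ext fun t => ?_, fun x y z t => ?_, fun x y z t => ?_,
      fun x y z t => ?_⟩
    · rw [eq_comm, ← sub_eq_zero, ← h, fst_sagleDefect_inr_inr_inr_inl]
    · rw [← neg_eq_zero, ← fst_sagleDefect_inl_inl_inl_inr, h]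
    · rw [← fst_sagleDefect_inl_inl_inr_inr, h]
    · rw [← neg_eq_zero, ← fst_sagleDefect_inl_inr_inl_inr, h]
  · rintro ⟨hrep, hM1, hM3, hM5⟩
    refine fst_sagleDefect_prodBilin_eq_zero b1 b2 ρ1 ρ2 h1 h2
      ((sagleIdentity_iff_sagleDefect_eq_zero _).1 h₀) (fun x y z t => ?_) (fun x y z t => ?_)
      (fun x y z t => ?_) fun x y z t => ?_
    · rw [fst_sagleDefect_inl_inl_inl_inr, neg_eq_zero]
      exact hM1 x y z t
    · rw [fst_sagleDefect_inl_inl_inr_inr]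
      exact hM3 x y z t
    · rw [fst_sagleDefect_inl_inr_inl_inr, neg_eq_zero]
      exact hM5 x y z t
    · rw [fst_sagleDefect_inr_inr_inr_inl, sub_eq_zero]
      exact (LinearMap.congr_fun (hrep x y z) t).symm

theorem sagleIdentity_prodBilin_iff :
    SagleIdentity (fun p q => prodBilin b1 b2 ρ1 ρ2 p q) ↔
      (∀ p q r s, (sagleDefect (fun p q => prodBilin b1 b2 ρ1 ρ2 p q) p q r s).1 = 0) ∧
        ∀ p q r s, (sagleDefect (fun p q => prodBilin b2 b1 ρ2 ρ1 p q) p q r s).1 = 0 := by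
  rw [sagleIdentity_iff_sagleDefect_eq_zero]
  constructor
  · intro h
    refine ⟨fun p q r s => congrArg Prod.fst (h p q r s), fun p q r s => ?_⟩
    exact congrArg Prod.snd (h p.swap q.swap r.swap s.swap)
  · rintro ⟨hl, hr⟩ p q r s
    exact Prod.ext (hl p q r s) (hr p.swap q.swap r.swap s.swap)

end SagleDefect

/-- The direct sum bracket of two Malcev algebras with a pair of linear
actions is a Malcev algebra iff `(A1,A2,ρ1,ρ2)` is a matched pair of Malcev algebras. -/
theorem prodBr_isMalcev_iff_matchedPair
    {A1 A2 : Type*} [AddCommGroup A1] [Module K A1] [AddCommGroup A2] [Module K A2]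
    (br1 : A1 → A1 → A1) (hbr1 : IsMalcev K br1)
    (br2 : A2 → A2 → A2) (hbr2 : IsMalcev K br2)
    (ρ1 : A1 → Module.End K A2) (hρ1 : IsLinearMap K ρ1)
    (ρ2 : A2 → Module.End K A1) (hρ2 : IsLinearMap K ρ2) :
    IsMalcev K (prodBr K br1 br2 ρ1 ρ2) ↔ IsMatchedPairMalcev K br1 br2 ρ1 ρ2 := by
  obtain ⟨b1, rfl⟩ := exists_bilin_of_isBilin K hbr1.1
  obtain ⟨b2, rfl⟩ := exists_bilin_of_isBilin K hbr2.1
  obtain ⟨ρ1, rfl⟩ : ∃ f : A1 →ₗ[K] Module.End K A2, f = ρ1 := ⟨hρ1.mk' ρ1, rfl⟩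
  obtain ⟨ρ2, rfl⟩ : ∃ f : A2 →ₗ[K] Module.End K A1, f = ρ2 := ⟨hρ2.mk' ρ2, rfl⟩
  have hmalcev : IsMalcev K (prodBr K (fun x y => b1 x y) (fun x y => b2 x y) ρ1 ρ2) ↔
      SagleIdentity fun p q => prodBilin b1 b2 ρ1 ρ2 p q :=
    ⟨fun h => h.2.2, fun h => ⟨isBilin_bilin (prodBilin b1 b2 ρ1 ρ2),
      isSkew_prodBilin b1 b2 ρ1 ρ2 hbr1.2.1 hbr2.2.1, h⟩⟩
  rw [hmalcev, sagleIdentity_prodBilin_iff,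
    fst_sagleDefect_prodBilin_eq_zero_iff b1 b2 ρ1 ρ2 hbr1.2.1 hbr2.2.1 hbr1.2.2,
    fst_sagleDefect_prodBilin_eq_zero_iff b2 b1 ρ2 ρ1 hbr2.2.1 hbr1.2.1 hbr2.2.2]
  constructor
  · rintro ⟨⟨hrep2, hcompat1⟩, hrep1, hcompat2⟩
    exact ⟨hbr1, hbr2, ⟨hρ1, hrep1⟩, ⟨hρ2, hrep2⟩, hcompat1, hcompat2⟩
  · rintro ⟨-, -, hrep1, hrep2, hcompat1, hcompat2⟩
    exact ⟨⟨hrep2.2, hcompat1⟩, hrep1.2, hcompat2⟩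

end MPA
end
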